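/- For every C > 0 and every η > 0 there exist ε₀ > 0 and N such that the following holds for all n ≥ N, all integers k with |k − (2·log₂ n − 2·log₂ log₂ n)| ≤ C, and all integers r with 2 ≤ r ≤ ε₀·(log log n)/(log log log n). The probability that in G_{n,1/2} there exist pairwise disjoint vertex sets A₁, …, A_{r−1}, each inducing at most k^{3/4} edges and each satisfying k − (r−2) ≤ |A_i| ≤ k+1, and subsets B_i ⊆ A_i with |B_i| ≥ k^{2/3} for each i, such that no clique on r−1 vertices has exactly one vertex in each B_i, is at most η/n. -/

import Mathlib

open scoped Classical

/-- Probability of an event under the uniform measure on simple graphs on `Fin n`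
(equivalently, `G_{n,1/2}`). -/
noncomputable def grPr (n : ℕ) (S : Set (SimpleGraph (Fin n))) : ℝ :=
  ((PMF.uniformOfFintype (SimpleGraph (Fin n))).toOuterMeasure S).toReal

/-- Number of edges of `G` with both endpoints in `s`. -/
noncomputable def edgesIn {n : ℕ} (G : SimpleGraph (Fin n)) (s : Finset (Fin n)) : ℕ :=
  {e ∈ G.edgeSet | ∀ v ∈ e, v ∈ s}.ncard

theorem grPr_eq (n : ℕ) (S : Set (SimpleGraph (Fin n))) :
    grPr n S = ((Finset.univ.filter (· ∈ S)).card : ℝ) / Fintype.card (SimpleGraph (Fin n)) := by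
  rw [grPr, PMF.toOuterMeasure_uniformOfFintype_apply, ENNReal.toReal_div, ENNReal.toReal_natCast,
    ENNReal.toReal_natCast, Fintype.card_subtype]

theorem grPr_le_sum {n : ℕ} {ι : Type*} (I : Finset ι) (S : Set (SimpleGraph (Fin n)))
    (E : ι → Set (SimpleGraph (Fin n))) (h : ∀ G ∈ S, ∃ i ∈ I, G ∈ E i) :
    grPr n S ≤ ∑ i ∈ I, grPr n (E i) := by
  simp only [grPr_eq]
  rw [← Finset.sum_div]
  gcongr
  have h1 : Finset.univ.filter (· ∈ S) ⊆ I.biUnion fun i => Finset.univ.filter (· ∈ E i) := by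
    intro G hG
    simpa using h G (by simpa using hG)
  exact_mod_cast (Finset.card_le_card h1).trans Finset.card_biUnion_le

/-- The edges of `G` as a finset. -/
noncomputable def edgesFin {n : ℕ} (G : SimpleGraph (Fin n)) : Finset (Sym2 (Fin n)) :=
  Finset.univ.filter (· ∈ G.edgeSet)

theorem mem_edgesFin {n : ℕ} {G : SimpleGraph (Fin n)} {e : Sym2 (Fin n)} :
    e ∈ edgesFin G ↔ e ∈ G.edgeSet := by simp [edgesFin]

theorem edgesFin_injective (n : ℕ) : Function.Injective (edgesFin (n := n)) := by
  intro G H h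
  refine SimpleGraph.edgeSet_injective ?_
  ext e
  rw [← mem_edgesFin, ← mem_edgesFin, h]

theorem card_edges_inter_eq_le {n : ℕ} (P Q : Finset (Sym2 (Fin n))) (hP : ∀ e ∈ P, ¬ e.IsDiag) :
    (Finset.univ.filter fun G : SimpleGraph (Fin n) => edgesFin G ∩ P = Q).card * 2 ^ P.card ≤
      Fintype.card (SimpleGraph (Fin n)) := by
  rw [← Finset.card_powerset, ← Finset.card_product, ← Finset.card_univ]
  have key : ∀ (G : SimpleGraph (Fin n)) (R : Finset (Sym2 (Fin n))), R ⊆ P →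
      edgesFin (SimpleGraph.fromEdgeSet (((edgesFin G \ P) ∪ R : Finset _) : Set (Sym2 (Fin n))))
        = (edgesFin G \ P) ∪ R := by
    intro G R hR
    ext e
    rw [mem_edgesFin, SimpleGraph.edgeSet_fromEdgeSet]
    simp only [Set.mem_sdiff, Finset.mem_coe, Sym2.mem_diagSet]
    refine and_iff_left_of_imp fun he => ?_
    rcases Finset.mem_union.1 he with he | he
    · exact G.not_isDiag_of_mem_edgeSet (mem_edgesFin.1 (Finset.mem_sdiff.1 he).1)
    · exact hP e (hR he)
  refine Finset.card_le_card_of_injOn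
    (fun x => SimpleGraph.fromEdgeSet (((edgesFin x.1 \ P) ∪ x.2 : Finset _) : Set (Sym2 (Fin n))))
    (fun _ _ => Finset.mem_coe.2 (Finset.mem_univ _)) ?_
  rintro ⟨G, R⟩ hG ⟨H, R'⟩ hH h
  simp only [Finset.coe_product, Set.mem_prod, Finset.mem_coe, Finset.mem_filter, Finset.mem_univ,
    true_and, Finset.mem_powerset] at hG hH
  have h2 := congrArg edgesFin h
  simp only [key G R hG.2, key H R' hH.2] at h2
  have hmem : ∀ e, e ∈ edgesFin G \ P ∪ R ↔ e ∈ edgesFin H \ P ∪ R' := fun e => by rw [h2]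
  have hQ : ∀ e, e ∈ edgesFin G ∩ P ↔ e ∈ edgesFin H ∩ P := fun e => by rw [hG.1, hH.1]
  simp only [Finset.mem_union, Finset.mem_sdiff, Finset.mem_inter] at hmem hQ
  ext1
  · refine edgesFin_injective n ?_
    ext e
    have := @hG.2 e
    have := @hH.2 e
    have := hmem e
    have := hQ e
    simp only
    tauto
  · ext e
    have := @hG.2 e
    have := @hH.2 e
    have := hmem e
    simp only
    tauto

theorem grPr_edges_inter_mem_le {n : ℕ} (P : Finset (Sym2 (Fin n))) (hP : ∀ e ∈ P, ¬ e.IsDiag)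
    (F : Finset (Finset (Sym2 (Fin n)))) :
    grPr n {G | edgesFin G ∩ P ∈ F} ≤ F.card / 2 ^ P.card := by
  calc grPr n {G | edgesFin G ∩ P ∈ F} ≤ ∑ Q ∈ F, grPr n {G | edgesFin G ∩ P = Q} :=
        grPr_le_sum _ _ _ fun G hG => ⟨_, hG, rfl⟩
    _ ≤ ∑ Q ∈ F, (1 : ℝ) / 2 ^ P.card := by
        refine Finset.sum_le_sum fun Q _ => ?_
        rw [grPr_eq, div_le_div_iff₀ (by exact_mod_cast Fintype.card_pos) (by positivity), one_mul]
        have h := card_edges_inter_eq_le P Q hP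
        simp only [Set.mem_ofPred_eq]
        exact_mod_cast h
    _ = F.card / 2 ^ P.card := by rw [Finset.sum_const, nsmul_eq_mul, mul_one_div]

theorem grPr_three_inter_le {n : ℕ} (P₁ P₂ P₃ : Finset (Sym2 (Fin n)))
    (h₁ : ∀ e ∈ P₁, ¬ e.IsDiag) (h₂ : ∀ e ∈ P₂, ¬ e.IsDiag) (h₃ : ∀ e ∈ P₃, ¬ e.IsDiag)
    (h₁₂ : Disjoint P₁ P₂) (h₁₃ : Disjoint P₁ P₃) (h₂₃ : Disjoint P₂ P₃)
    (F₁ F₂ F₃ : Finset (Finset (Sym2 (Fin n)))) :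
    grPr n {G | edgesFin G ∩ P₁ ∈ F₁ ∧ edgesFin G ∩ P₂ ∈ F₂ ∧ edgesFin G ∩ P₃ ∈ F₃} ≤
      (F₁.card / 2 ^ P₁.card) * (F₂.card / 2 ^ P₂.card) * (F₃.card / 2 ^ P₃.card) := by
  let F := (F₁ ×ˢ F₂ ×ˢ F₃).image fun x => x.1 ∪ (x.2.1 ∪ x.2.2)
  have hF : F.card ≤ F₁.card * (F₂.card * F₃.card) := by
    rw [← Finset.card_product, ← Finset.card_product]
    exact Finset.card_image_le
  have hle : grPr n {G | edgesFin G ∩ P₁ ∈ F₁ ∧ edgesFin G ∩ P₂ ∈ F₂ ∧ edgesFin G ∩ P₃ ∈ F₃} ≤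
      grPr n {G | edgesFin G ∩ (P₁ ∪ (P₂ ∪ P₃)) ∈ F} := by
    refine (grPr_le_sum {()} _ (fun _ => {G | edgesFin G ∩ (P₁ ∪ (P₂ ∪ P₃)) ∈ F}) ?_).trans
      (by simp)
    rintro G ⟨g₁, g₂, g₃⟩
    refine ⟨(), by simp, Finset.mem_image.2
      ⟨(edgesFin G ∩ P₁, edgesFin G ∩ P₂, edgesFin G ∩ P₃), by simp [g₁, g₂, g₃], ?_⟩⟩
    simp only [Finset.inter_union_distrib_left]
  refine hle.trans ((grPr_edges_inter_mem_le _ ?_ F).trans ?_)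
  · intro e he
    simp only [Finset.mem_union] at he
    rcases he with he | he | he
    exacts [h₁ e he, h₂ e he, h₃ e he]
  · rw [Finset.card_union_of_disjoint (Finset.disjoint_union_right.2 ⟨h₁₂, h₁₃⟩),
      Finset.card_union_of_disjoint h₂₃, pow_add, pow_add, div_mul_div_comm, div_mul_div_comm,
      mul_assoc, mul_assoc]
    gcongr
    exact_mod_cast hF

theorem card_powerset_filter_le {α : Type*} (X : Finset α) (s : ℝ) {y : ℝ} (hy : 0 < y)
    (hy1 : y ≤ 1) :
    ((X.powerset.filter fun Q => (Q.card : ℝ) ≤ s).card : ℝ) ≤ y ^ (-s) * (y + 1) ^ X.card := by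
  calc ((X.powerset.filter fun Q => (Q.card : ℝ) ≤ s).card : ℝ)
      = ∑ Q ∈ X.powerset.filter fun Q => (Q.card : ℝ) ≤ s, (1 : ℝ) := by simp
    _ ≤ ∑ Q ∈ X.powerset.filter fun Q => (Q.card : ℝ) ≤ s, y ^ (-s) * y ^ Q.card := by
        refine Finset.sum_le_sum fun Q hQ => ?_
        rw [← Real.rpow_natCast, ← Real.rpow_add hy]
        refine Real.one_le_rpow_of_pos_of_le_one_of_nonpos hy hy1 ?_
        linarith [(Finset.mem_filter.1 hQ).2]
    _ ≤ ∑ Q ∈ X.powerset, y ^ (-s) * y ^ Q.card :=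
        Finset.sum_le_sum_of_subset_of_nonneg (Finset.filter_subset _ _)
          fun _ _ _ => by positivity
    _ = y ^ (-s) * (y + 1) ^ X.card := by
        rw [← Finset.mul_sum, ← Finset.sum_pow_mul_eq_add_pow]
        simp

theorem one_div_add_one_pow_le {M : ℝ} (hM : 0 < M) {a : ℕ} (ha : (a : ℝ) ≤ M) :
    (1 / M + 1) ^ a ≤ 3 := by
  calc (1 / M + 1) ^ a ≤ (Real.exp (1 / M)) ^ a := by
        gcongr
        exact Real.add_one_le_exp _
    _ = Real.exp (a / M) := by rw [← Real.exp_nat_mul, mul_one_div]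
    _ ≤ Real.exp 1 := by
        gcongr
        exact (div_le_one hM).2 ha
    _ ≤ 3 := by linarith [Real.exp_one_lt_d9]

theorem card_powerset_filter_le_of_card_le {α : Type*} (X : Finset α) (s : ℝ) {M : ℝ}
    (hM : 1 ≤ M) (hX : (X.card : ℝ) ≤ M) :
    ((X.powerset.filter fun Q => (Q.card : ℝ) ≤ s).card : ℝ) ≤ 3 * M ^ s := by
  have hM0 : 0 < M := by linarith
  have h := card_powerset_filter_le X s (y := 1 / M) (by positivity) ((div_le_one hM0).2 hM)
  refine h.trans ?_
  rw [mul_comm, one_div, Real.inv_rpow hM0.le, Real.rpow_neg hM0.le, inv_inv, ← one_div]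
  gcongr
  exact one_div_add_one_pow_le hM0 hX

theorem card_powerset_filter_eighth_le {α : Type*} (X : Finset α) :
    ((X.powerset.filter fun Q => (Q.card : ℝ) ≤ X.card / 8).card : ℝ) / 2 ^ X.card ≤
      (2 : ℝ) ^ (-(X.card / 8 : ℝ)) := by
  have h := card_powerset_filter_le X (X.card / 8) (y := 1 / 2) (by norm_num) (by norm_num)
  rw [div_le_iff₀ (by positivity)]
  refine h.trans ?_
  have h34 : (1 / 2 + 1 : ℝ) ≤ (2 : ℝ) ^ (3 / 4 : ℝ) := by
    refine le_of_pow_le_pow_left₀ (n := 4) (by norm_num) (by positivity) ?_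
    rw [← Real.rpow_natCast ((2 : ℝ) ^ (3 / 4 : ℝ)), ← Real.rpow_mul (by norm_num)]
    norm_num
  calc (1 / 2 : ℝ) ^ (-(X.card / 8 : ℝ)) * (1 / 2 + 1) ^ X.card
      ≤ (1 / 2 : ℝ) ^ (-(X.card / 8 : ℝ)) * ((2 : ℝ) ^ (3 / 4 : ℝ)) ^ X.card := by gcongr
    _ = (2 : ℝ) ^ (-(X.card / 8 : ℝ)) * 2 ^ X.card := by
        rw [one_div, Real.inv_rpow (by norm_num), ← Real.rpow_neg (by norm_num), neg_neg,
          ← Real.rpow_natCast, ← Real.rpow_natCast, ← Real.rpow_mul (by norm_num),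
          ← Real.rpow_add (by norm_num), ← Real.rpow_add (by norm_num)]
        congr 1
        ring

/-- The pairs of distinct elements of `A`. -/
noncomputable def pairsIn {n : ℕ} (A : Finset (Fin n)) : Finset (Sym2 (Fin n)) :=
  A.offDiag.image (Function.uncurry Sym2.mk)

theorem mem_pairsIn {n : ℕ} {A : Finset (Fin n)} {e : Sym2 (Fin n)} :
    e ∈ pairsIn A ↔ (∀ v ∈ e, v ∈ A) ∧ ¬ e.IsDiag := by
  induction e with
  | _ x y =>
    simp only [pairsIn, Finset.mem_image, Finset.mem_offDiag, Prod.exists, Sym2.mem_iff,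
      Sym2.mk_isDiag_iff]
    constructor
    · rintro ⟨a, b, ⟨ha, hb, hab⟩, h⟩
      rcases Sym2.eq_iff.1 h with ⟨rfl, rfl⟩ | ⟨rfl, rfl⟩
      · exact ⟨by rintro v (rfl | rfl) <;> assumption, hab⟩
      · exact ⟨by rintro v (rfl | rfl) <;> assumption, Ne.symm hab⟩
    · rintro ⟨h, hxy⟩
      exact ⟨x, y, ⟨h x (Or.inl rfl), h y (Or.inr rfl), hxy⟩, rfl⟩

theorem card_pairsIn {n : ℕ} (A : Finset (Fin n)) : (pairsIn A).card = A.card.choose 2 :=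
  Sym2.card_image_offDiag A

theorem edgesIn_eq_card {n : ℕ} (G : SimpleGraph (Fin n)) (A : Finset (Fin n)) :
    edgesIn G A = (edgesFin G ∩ pairsIn A).card := by
  rw [edgesIn, ← Set.ncard_coe_finset]
  congr 1
  ext e
  simp only [Set.mem_ofPred_eq, Finset.coe_inter, Set.mem_inter_iff, Finset.mem_coe, mem_edgesFin,
    mem_pairsIn]
  constructor
  · exact fun h => ⟨h.1, h.2, G.not_isDiag_of_mem_edgeSet h.1⟩
  · exact fun h => ⟨h.1, h.2.1⟩

/-- The pairs with one element in `T` and the other one in `S`. -/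
noncomputable def pairsBetween {n : ℕ} (T S : Finset (Fin n)) : Finset (Sym2 (Fin n)) :=
  (T ×ˢ S).image (Function.uncurry Sym2.mk)

theorem card_pairsBetween {n : ℕ} {T S : Finset (Fin n)} (h : Disjoint T S) :
    (pairsBetween T S).card = T.card * S.card := by
  rw [pairsBetween, Finset.card_image_of_injOn, Finset.card_product]
  rintro ⟨a, b⟩ hab ⟨c, d⟩ hcd heq
  simp only [Finset.coe_product, Set.mem_prod, Finset.mem_coe] at hab hcd
  rcases Sym2.eq_iff.1 heq with ⟨rfl, rfl⟩ | ⟨rfl, rfl⟩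
  · rfl
  · exact absurd hcd.2 (Finset.disjoint_left.1 h hab.1)

theorem mem_pairsBetween {n : ℕ} {T S : Finset (Fin n)} {e : Sym2 (Fin n)} :
    e ∈ pairsBetween T S ↔ ∃ x ∈ T, ∃ y ∈ S, s(x, y) = e := by
  simp only [pairsBetween, Finset.mem_image, Finset.mem_product, Prod.exists]
  constructor
  · rintro ⟨a, b, ⟨ha, hb⟩, h⟩
    exact ⟨a, ha, b, hb, h⟩
  · rintro ⟨a, ha, b, hb, h⟩
    exact ⟨a, b, ⟨ha, hb⟩, h⟩

theorem card_edges_between_le {n : ℕ} (G : SimpleGraph (Fin n)) (T S : Finset (Fin n))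
    (h : ∀ v ∈ T, 8 * (S.filter (G.Adj v)).card ≤ S.card) :
    8 * (edgesFin G ∩ pairsBetween T S).card ≤ T.card * S.card := by
  have hsub : edgesFin G ∩ pairsBetween T S ⊆
      T.biUnion fun v => (S.filter (G.Adj v)).image fun u => s(v, u) := by
    intro e he
    obtain ⟨he, h2⟩ := Finset.mem_inter.1 he
    obtain ⟨x, hx, y, hy, rfl⟩ := mem_pairsBetween.1 h2
    rw [mem_edgesFin, SimpleGraph.mem_edgeSet] at he
    exact Finset.mem_biUnion.2 ⟨x, hx, Finset.mem_image.2 ⟨y, by simp [hy, he], rfl⟩⟩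
  calc 8 * (edgesFin G ∩ pairsBetween T S).card
      ≤ 8 * ∑ v ∈ T, (S.filter (G.Adj v)).card := by
        gcongr
        refine (Finset.card_le_card hsub).trans (Finset.card_biUnion_le.trans ?_)
        exact Finset.sum_le_sum fun v _ => Finset.card_image_le
    _ = ∑ v ∈ T, 8 * (S.filter (G.Adj v)).card := Finset.mul_sum _ _ _
    _ ≤ ∑ v ∈ T, S.card := Finset.sum_le_sum h
    _ = T.card * S.card := by simp

theorem grPr_sparse_pair_le {n : ℕ} {A A' T S : Finset (Fin n)} (hA : Disjoint A A') (hT : T ⊆ A)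
    (hS : S ⊆ A') {s M : ℝ} (hM : 1 ≤ M) (hAM : (A.card.choose 2 : ℝ) ≤ M)
    (hAM' : (A'.card.choose 2 : ℝ) ≤ M) :
    grPr n {G | (edgesIn G A : ℝ) ≤ s ∧ (edgesIn G A' : ℝ) ≤ s ∧
        ∀ v ∈ T, 8 * (S.filter (G.Adj v)).card ≤ S.card} ≤
      (3 * M ^ s / 2 ^ A.card.choose 2) * (3 * M ^ s / 2 ^ A'.card.choose 2) *
        (2 : ℝ) ^ (-(T.card * S.card / 8 : ℝ)) := by
  have hTS : Disjoint T S :=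
    Finset.disjoint_of_subset_left hT (Finset.disjoint_of_subset_right hS hA)
  have hdisj := Finset.disjoint_left.1 hA
  let light := fun X : Finset (Sym2 (Fin n)) => X.powerset.filter fun Q => (Q.card : ℝ) ≤ s
  let P := pairsBetween T S
  let F₃ := P.powerset.filter fun Q => (Q.card : ℝ) ≤ P.card / 8
  have hP : P.card = T.card * S.card := card_pairsBetween hTS
  have key := grPr_three_inter_le (pairsIn A) (pairsIn A') P
    (fun e he => (mem_pairsIn.1 he).2) (fun e he => (mem_pairsIn.1 he).2) ?_ ?_ ?_ ?_
    (light (pairsIn A)) (light (pairsIn A')) F₃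
  · refine (grPr_le_sum {()} _ (fun _ => _) ?_).trans
      ((Finset.sum_singleton _ _).le.trans (key.trans ?_))
    · rintro G ⟨g₁, g₂, g₃⟩
      refine ⟨(), by simp, ?_, ?_, ?_⟩
      · exact Finset.mem_filter.2 ⟨Finset.mem_powerset.2 Finset.inter_subset_right,
          by rwa [← edgesIn_eq_card]⟩
      · exact Finset.mem_filter.2 ⟨Finset.mem_powerset.2 Finset.inter_subset_right,
          by rwa [← edgesIn_eq_card]⟩
      · refine Finset.mem_filter.2 ⟨Finset.mem_powerset.2 Finset.inter_subset_right, ?_⟩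
        rw [le_div_iff₀ (by norm_num), hP, mul_comm]
        exact_mod_cast card_edges_between_le G T S g₃
    · have h3 := card_powerset_filter_eighth_le P
      rw [card_pairsIn, card_pairsIn]
      have e1 : ((light (pairsIn A)).card : ℝ) ≤ 3 * M ^ s :=
        card_powerset_filter_le_of_card_le _ _ hM (by rwa [card_pairsIn])
      have e2 : ((light (pairsIn A')).card : ℝ) ≤ 3 * M ^ s :=
        card_powerset_filter_le_of_card_le _ _ hM (by rwa [card_pairsIn])
      have hM0 : 0 < M := by linarith
      have e3 : (F₃.card : ℝ) / 2 ^ P.card ≤ (2 : ℝ) ^ (-(T.card * S.card / 8 : ℝ)) := by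
        rw [← Nat.cast_mul, ← hP]
        exact h3
      gcongr
  · intro e he
    obtain ⟨x, hx, y, hy, rfl⟩ := mem_pairsBetween.1 he
    rw [Sym2.mk_isDiag_iff]
    rintro rfl
    exact hdisj (hT hx) (hS hy)
  · refine Finset.disjoint_left.2 fun e he he' => ?_
    rw [mem_pairsIn] at he he'
    induction e with
    | _ x y => exact hdisj (he.1 x (by simp)) (he'.1 x (by simp))
  · refine Finset.disjoint_left.2 fun e he he' => ?_
    obtain ⟨x, hx, y, hy, rfl⟩ := mem_pairsBetween.1 he'
    exact hdisj ((mem_pairsIn.1 he).1 y (by simp)) (hS hy)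
  · refine Finset.disjoint_left.2 fun e he he' => ?_
    obtain ⟨x, hx, y, hy, rfl⟩ := mem_pairsBetween.1 he'
    exact hdisj (hT hx) ((mem_pairsIn.1 he).1 x (by simp))

/-- Greedy embedding of a transversal clique when no pair of large subsets of different parts is
too sparse. -/
theorem exists_transversal_clique {V ι : Type*} [Nonempty V] (G : SimpleGraph V) (B : ι → Finset V)
    {t : ℕ} (ht : 0 < t)
    (h : ∀ i j, i ≠ j → ∀ T ⊆ B i, ∀ S ⊆ B j, t ≤ T.card → t ≤ S.card →
      ∃ v ∈ T, S.card < 8 * (S.filter (G.Adj v)).card) (I : Finset ι) :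
    ∀ S : ι → Finset V, (∀ i ∈ I, S i ⊆ B i ∧ 8 ^ I.card * t ≤ (S i).card) →
      ∃ v : ι → V, (∀ i ∈ I, v i ∈ S i) ∧ ∀ i ∈ I, ∀ j ∈ I, i ≠ j → G.Adj (v i) (v j) := by
  induction I using Finset.induction_on with
  | empty =>
    intro S _
    exact ⟨fun _ => Classical.arbitrary V, by simp, by simp⟩
  | insert i₀ I hi₀ ih =>
    intro S hS
    rw [Finset.card_insert_of_notMem hi₀] at hS
    let T := fun j => (S i₀).filter fun v => 8 * ((S j).filter (G.Adj v)).card ≤ (S j).card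
    have hT : ∀ j ∈ I, (T j).card ≤ t := by
      intro j hj
      by_contra! hlt
      have hne : i₀ ≠ j := fun e => hi₀ (e ▸ hj)
      obtain ⟨hjB, hjc⟩ := hS j (Finset.mem_insert_of_mem hj)
      obtain ⟨v, hv, hv'⟩ := h i₀ j hne (T j)
        ((Finset.filter_subset _ _).trans (hS i₀ (Finset.mem_insert_self _ _)).1) (S j) hjB hlt.le
        ((Nat.le_mul_of_pos_left t (by positivity)).trans hjc)
      exact absurd (Finset.mem_filter.1 hv).2 (by omega)
    obtain ⟨hiB, hic⟩ := hS i₀ (Finset.mem_insert_self _ _)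
    have hlt : (I.biUnion T).card < (S i₀).card := by
      calc (I.biUnion T).card ≤ I.card * t := Finset.card_biUnion_le_card_mul _ _ _ hT
        _ < 8 ^ (I.card + 1) * t := by
          refine Nat.mul_lt_mul_of_pos_right ?_ ht
          exact (Nat.lt_succ_self _).trans (Nat.lt_pow_self (by norm_num))
        _ ≤ _ := hic
    obtain ⟨x, hx, hxT⟩ := Finset.exists_mem_notMem_of_card_lt_card hlt
    obtain ⟨v, hv, hadj⟩ := ih (fun j => (S j).filter (G.Adj x)) (by
      intro j hj
      obtain ⟨hjB, hjc⟩ := hS j (Finset.mem_insert_of_mem hj)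
      refine ⟨(Finset.filter_subset _ _).trans hjB, ?_⟩
      have : ¬ (8 * ((S j).filter (G.Adj x)).card ≤ (S j).card) := fun hle =>
        hxT (Finset.mem_biUnion.2 ⟨j, hj, Finset.mem_filter.2 ⟨hx, hle⟩⟩)
      rw [pow_succ] at hjc
      nlinarith)
    have hne : ∀ j ∈ I, j ≠ i₀ := fun j hj e => hi₀ (e ▸ hj)
    refine ⟨Function.update v i₀ x, ?_, ?_⟩
    · intro i hi
      rcases Finset.mem_insert.1 hi with rfl | hi
      · simpa using hx
      · rw [Function.update_of_ne (hne i hi)]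
        exact (Finset.mem_filter.1 (hv i hi)).1
    · intro i hi j hj hij
      rcases Finset.mem_insert.1 hi with rfl | hi' <;> rcases Finset.mem_insert.1 hj with rfl | hj'
      · exact absurd rfl hij
      · rw [Function.update_self, Function.update_of_ne (hne j hj')]
        exact (Finset.mem_filter.1 (hv j hj')).2
      · rw [Function.update_self, Function.update_of_ne (hne i hi')]
        exact (Finset.mem_filter.1 (hv i hi')).2.symm
      · rw [Function.update_of_ne (hne i hi'), Function.update_of_ne (hne j hj')]
        exact hadj i hi' j hj' hij

theorem grPr_mono {n : ℕ} {S S' : Set (SimpleGraph (Fin n))} (h : S ⊆ S') :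
    grPr n S ≤ grPr n S' :=
  (grPr_le_sum {()} S (fun _ => S') fun _ hG => ⟨(), by simp, h hG⟩).trans (by simp)

theorem sum_sigma_powerset_le {n : ℕ} (hn : 0 < n) (𝒜 : Finset (Finset (Fin n))) {D : ℝ}
    (hD : 0 ≤ D) (h : ∀ A ∈ 𝒜, 2 ^ A.card * (n : ℝ) ^ A.card / 2 ^ A.card.choose 2 ≤ D) :
    ∑ x ∈ 𝒜.sigma fun A => A.powerset, (1 : ℝ) / 2 ^ x.1.card.choose 2 ≤ 3 * D := by
  have hn' : (0 : ℝ) < n := by exact_mod_cast hn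
  rw [Finset.sum_sigma]
  calc ∑ A ∈ 𝒜, ∑ _T ∈ A.powerset, (1 : ℝ) / 2 ^ A.card.choose 2
      ≤ ∑ A ∈ 𝒜, D * (1 / (n : ℝ)) ^ A.card := by
        refine Finset.sum_le_sum fun A hA => ?_
        rw [Finset.sum_const, Finset.card_powerset, nsmul_eq_mul, one_div_pow, mul_one_div,
          mul_one_div, le_div_iff₀ (by positivity)]
        refine le_trans (le_of_eq ?_) (h A hA)
        push_cast
        ring
    _ ≤ ∑ A : Finset (Fin n), D * (1 / (n : ℝ)) ^ A.card :=
        Finset.sum_le_sum_of_subset_of_nonneg (Finset.subset_univ _) fun _ _ _ => by positivity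
    _ = D * (1 / (n : ℝ) + 1) ^ n := by
        have := Fintype.sum_pow_mul_eq_add_pow (Fin n) (1 / (n : ℝ)) 1
        simp only [one_pow, mul_one, Fintype.card_fin] at this
        rw [← this, Finset.mul_sum]
    _ ≤ 3 * D := by
        rw [mul_comm]
        gcongr
        exact one_div_add_one_pow_le hn' le_rfl

theorem grPr_exists_sparse_pair_le {n : ℕ} (hn : 0 < n) (lo hi t : ℕ) {s M D : ℝ} (hM : 1 ≤ M)
    (hD : 0 ≤ D) (haM : ∀ a, lo ≤ a → a ≤ hi → (a.choose 2 : ℝ) ≤ M)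
    (haD : ∀ a, lo ≤ a → a ≤ hi → 2 ^ a * (n : ℝ) ^ a / 2 ^ a.choose 2 ≤ D) :
    grPr n {G | ∃ A A' T S : Finset (Fin n), Disjoint A A' ∧ (lo ≤ A.card ∧ A.card ≤ hi) ∧
        (lo ≤ A'.card ∧ A'.card ≤ hi) ∧ T ⊆ A ∧ S ⊆ A' ∧ t ≤ T.card ∧ t ≤ S.card ∧
        (edgesIn G A : ℝ) ≤ s ∧ (edgesIn G A' : ℝ) ≤ s ∧
        ∀ v ∈ T, 8 * (S.filter (G.Adj v)).card ≤ S.card} ≤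
      (9 * M ^ s * D) ^ 2 * (2 : ℝ) ^ (-((t : ℝ) ^ 2 / 8)) := by
  let 𝒜 : Finset (Finset (Fin n)) := Finset.univ.filter fun A => lo ≤ A.card ∧ A.card ≤ hi
  let J := 𝒜.sigma fun A => A.powerset
  let w : (Σ _ : Finset (Fin n), Finset (Fin n)) → ℝ := fun x => 1 / 2 ^ x.1.card.choose 2
  let I := (J ×ˢ J).filter fun x =>
    Disjoint x.1.1 x.2.1 ∧ t ≤ x.1.2.card ∧ t ≤ x.2.2.card
  have hM0 : 0 < M := by linarith
  have hJ : ∑ x ∈ J, w x ≤ 3 * D := by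
    refine sum_sigma_powerset_le hn 𝒜 hD fun A hA => ?_
    have := (Finset.mem_filter.1 hA).2
    exact haD _ this.1 this.2
  have hJ0 : 0 ≤ ∑ x ∈ J, w x := Finset.sum_nonneg fun _ _ => by positivity
  have hu := grPr_le_sum I {G | ∃ A A' T S : Finset (Fin n), Disjoint A A' ∧
        (lo ≤ A.card ∧ A.card ≤ hi) ∧
        (lo ≤ A'.card ∧ A'.card ≤ hi) ∧ T ⊆ A ∧ S ⊆ A' ∧ t ≤ T.card ∧ t ≤ S.card ∧
        (edgesIn G A : ℝ) ≤ s ∧ (edgesIn G A' : ℝ) ≤ s ∧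
        ∀ v ∈ T, 8 * (S.filter (G.Adj v)).card ≤ S.card}
      (fun x => {G | (edgesIn G x.1.1 : ℝ) ≤ s ∧ (edgesIn G x.2.1 : ℝ) ≤ s ∧
        ∀ v ∈ x.1.2, 8 * (x.2.2.filter (G.Adj v)).card ≤ x.2.2.card}) (by
    rintro G ⟨A, A', T, S, hA, h1, h2, hT, hS, h3, h4, h5⟩
    refine ⟨(⟨A, T⟩, ⟨A', S⟩), ?_, h5⟩
    simp only [I, J, 𝒜, Finset.mem_filter, Finset.mem_product, Finset.mem_sigma, Finset.mem_univ,
      Finset.mem_powerset, true_and]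
    exact ⟨⟨⟨h1, hT⟩, h2, hS⟩, hA, h3, h4⟩)
  refine hu.trans ?_
  calc _ ≤ ∑ x ∈ I, (3 * M ^ s) ^ 2 * (2 : ℝ) ^ (-((t : ℝ) ^ 2 / 8)) * (w x.1 * w x.2) := by
        refine Finset.sum_le_sum fun x hx => ?_
        obtain ⟨⟨A, T⟩, ⟨A', S⟩⟩ := x
        simp only [I, J, 𝒜, Finset.mem_filter, Finset.mem_product, Finset.mem_sigma,
          Finset.mem_univ, Finset.mem_powerset, true_and] at hx
        obtain ⟨⟨⟨h1, hT⟩, h2, hS⟩, hA, h3, h4⟩ := hx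
        refine (grPr_sparse_pair_le hA hT hS hM (haM _ h1.1 h1.2) (haM _ h2.1 h2.2)).trans ?_
        have ht : (t : ℝ) ^ 2 ≤ T.card * S.card := by
          rw [sq]
          exact_mod_cast Nat.mul_le_mul h3 h4
        calc _ ≤ (3 * M ^ s / 2 ^ A.card.choose 2) * (3 * M ^ s / 2 ^ A'.card.choose 2) *
              (2 : ℝ) ^ (-((t : ℝ) ^ 2 / 8)) := by
              gcongr
              norm_num
          _ = _ := by
              simp only [w]
              ring
    _ ≤ ∑ x ∈ J ×ˢ J, (3 * M ^ s) ^ 2 * (2 : ℝ) ^ (-((t : ℝ) ^ 2 / 8)) * (w x.1 * w x.2) :=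
        Finset.sum_le_sum_of_subset_of_nonneg (Finset.filter_subset _ _)
          fun _ _ _ => by positivity
    _ = (3 * M ^ s) ^ 2 * (2 : ℝ) ^ (-((t : ℝ) ^ 2 / 8)) * (∑ x ∈ J, w x) ^ 2 := by
        rw [← Finset.mul_sum, Finset.sum_product, sq (∑ x ∈ J, w x), Finset.sum_mul_sum]
    _ ≤ (3 * M ^ s) ^ 2 * (2 : ℝ) ^ (-((t : ℝ) ^ 2 / 8)) * (3 * D) ^ 2 := by gcongr
    _ = _ := by ring

theorem exists_sparse_pair {n m t : ℕ} [Nonempty (Fin n)] (ht : 0 < t) (G : SimpleGraph (Fin n))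
    (B : Fin m → Finset (Fin n)) (hB : ∀ i, 8 ^ m * t ≤ (B i).card)
    (h : ¬ ∃ v : Fin m → Fin n, (∀ i, v i ∈ B i) ∧ ∀ i j, i ≠ j → G.Adj (v i) (v j)) :
    ∃ i j, i ≠ j ∧ ∃ T ⊆ B i, ∃ S ⊆ B j, t ≤ T.card ∧ t ≤ S.card ∧
      ∀ v ∈ T, 8 * (S.filter (G.Adj v)).card ≤ S.card := by
  by_contra! hc
  obtain ⟨v, hv, hadj⟩ := exists_transversal_clique G B ht
    (fun i j hij T hT S hS h1 h2 => hc i j hij T hT S hS h1 h2) Finset.univ B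
    (fun i _ => ⟨subset_rfl, by simpa using hB i⟩)
  exact h ⟨v, fun i => hv i (Finset.mem_univ i),
    fun i j hij => hadj i (Finset.mem_univ i) j (Finset.mem_univ j) hij⟩

theorem isLittleO_rpow_rpow_atTop {a b : ℝ} (h : a < b) :
    (fun x : ℝ => x ^ a) =o[Filter.atTop] fun x : ℝ => x ^ b := by
  refine Asymptotics.isLittleO_of_tendsto' ?_ ?_
  · filter_upwards [Filter.eventually_gt_atTop 0] with x hx h0
    exact absurd h0 (Real.rpow_pos_of_pos hx _).ne'
  · refine (tendsto_rpow_neg_atTop (sub_pos.2 h)).congr' ?_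
    filter_upwards [Filter.eventually_gt_atTop 0] with x hx
    rw [← Real.rpow_sub hx, neg_sub]

theorem isLittleO_const_rpow_atTop (c : ℝ) {b : ℝ} (h : 0 < b) :
    (fun _ : ℝ => c) =o[Filter.atTop] fun x : ℝ => x ^ b := by
  have := (isLittleO_rpow_rpow_atTop h).const_mul_left c
  simpa using this

theorem eventually_logb_add_log_le (c : ℝ) :
    ∀ᶠ x : ℝ in Filter.atTop, c + Real.logb 2 x + Real.log x ≤ x ^ (1 / 10 : ℝ) := by
  have hlog : Real.log =o[Filter.atTop] fun x : ℝ => x ^ (1 / 10 : ℝ) :=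
    isLittleO_log_rpow_atTop (by norm_num)
  have h := ((isLittleO_const_rpow_atTop c (b := 1 / 10) (by norm_num)).add
    (hlog.const_mul_left (Real.log 2)⁻¹)).add hlog
  filter_upwards [h.bound one_pos, Filter.eventually_gt_atTop 0] with x hx hx0
  rw [one_mul, Real.norm_of_nonneg (by positivity : (0 : ℝ) ≤ x ^ (1 / 10 : ℝ))] at hx
  refine le_trans (le_of_eq ?_) ((Real.le_norm_self _).trans hx)
  rw [Real.logb]
  ring

theorem eventually_rpow_mul_le :
    ∀ᶠ x : ℝ in Filter.atTop, x ^ (3 / 100 : ℝ) * (x ^ (3 / 5 : ℝ) + 1) ≤ x ^ (2 / 3 : ℝ) := by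
  have h := (isLittleO_rpow_rpow_atTop (a := 3 / 100 + 3 / 5) (b := 2 / 3) (by norm_num)).add
    (isLittleO_rpow_rpow_atTop (a := 3 / 100) (b := 2 / 3) (by norm_num))
  filter_upwards [h.bound one_pos, Filter.eventually_gt_atTop 0] with x hx hx0
  rw [one_mul, Real.norm_of_nonneg (by positivity : (0 : ℝ) ≤ x ^ (2 / 3 : ℝ))] at hx
  refine le_trans (le_of_eq ?_) ((Real.le_norm_self _).trans hx)
  rw [Real.rpow_add hx0]
  ring

theorem eventually_union_bound_le {η : ℝ} (hη : 0 < η) :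
    ∀ᶠ x : ℝ in Filter.atTop,
      (9 * (x ^ (3 : ℝ)) ^ (x ^ (3 / 4 : ℝ)) * (2 : ℝ) ^ ((x + 1) * x ^ (1 / 10 : ℝ))) ^ 2 *
        (2 : ℝ) ^ (-((x ^ (3 / 5 : ℝ)) ^ 2 / 8)) ≤ η / 2 ^ x := by
  have hlog : Real.log =o[Filter.atTop] fun x : ℝ => x ^ (9 / 20 : ℝ) :=
    isLittleO_log_rpow_atTop (by norm_num)
  have hmul : (fun x : ℝ => x ^ (3 / 4 : ℝ) * Real.log x) =o[Filter.atTop]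
      fun x : ℝ => x ^ (6 / 5 : ℝ) := by
    refine ((Asymptotics.isBigO_refl (fun x : ℝ => x ^ (3 / 4 : ℝ)) _).mul_isLittleO hlog).congr'
      Filter.EventuallyEq.rfl ?_
    filter_upwards [Filter.eventually_gt_atTop 0] with x hx
    rw [← Real.rpow_add hx]
    norm_num
  have h := (((((isLittleO_const_rpow_atTop (2 * Real.log 9 - Real.log η) (b := 6 / 5)
    (by norm_num)).add (hmul.const_mul_left 6)).add
    ((isLittleO_rpow_rpow_atTop (a := 1 + 1 / 10) (b := 6 / 5)
      (by norm_num)).const_mul_left (2 * Real.log 2))).add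
    ((isLittleO_rpow_rpow_atTop (a := 1 / 10) (b := 6 / 5)
      (by norm_num)).const_mul_left (2 * Real.log 2))).add
    ((isLittleO_rpow_rpow_atTop (a := 1) (b := 6 / 5)
      (by norm_num)).const_mul_left (Real.log 2)))
  have hl2 : 0 < Real.log 2 := Real.log_pos (by norm_num)
  filter_upwards [h.bound (show 0 < Real.log 2 / 8 by positivity),
    Filter.eventually_gt_atTop 0] with x hx hx0
  rw [Real.norm_of_nonneg (by positivity : (0 : ℝ) ≤ x ^ (6 / 5 : ℝ))] at hx
  have hx := (Real.le_norm_self _).trans hx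
  rw [← Real.log_le_log_iff (by positivity) (by positivity),
    Real.log_mul (by positivity) (by positivity), Real.log_pow,
    Real.log_mul (by positivity) (by positivity), Real.log_mul (by positivity) (by positivity),
    Real.log_rpow (by positivity), Real.log_rpow (by positivity), Real.log_rpow (by positivity),
    Real.log_rpow (by positivity), Real.log_div (by positivity) (by positivity),
    Real.log_rpow (by positivity)]
  have hsq : (x ^ (3 / 5 : ℝ)) ^ 2 = x ^ (6 / 5 : ℝ) := by
    rw [← Real.rpow_natCast, ← Real.rpow_mul hx0.le]
    norm_num
  rw [Real.rpow_add hx0, Real.rpow_one] at hx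
  rw [hsq]
  push_cast
  linarith

theorem weight_le {n k r a : ℕ} {C : ℝ} (hn : 0 < n) (hr : 2 ≤ r) (hlo : k - (r - 2) ≤ a)
    (hhi : a ≤ k + 1) (hL : 2 * Real.logb 2 n ≤ k + C + 2 * Real.logb 2 k)
    (hrk : (r : ℝ) ≤ Real.log k)
    (hk : 1 + C / 2 + Real.logb 2 k + Real.log k ≤ (k : ℝ) ^ (1 / 10 : ℝ)) :
    2 ^ a * (n : ℝ) ^ a / 2 ^ a.choose 2 ≤ (2 : ℝ) ^ (((k : ℝ) + 1) * (k : ℝ) ^ (1 / 10 : ℝ)) := by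
  have hn0 : (0 : ℝ) < n := by exact_mod_cast hn
  have e1 : (2 : ℝ) ^ a * (n : ℝ) ^ a / 2 ^ a.choose 2 =
      (2 : ℝ) ^ ((a : ℝ) * (1 + Real.logb 2 n - (a - 1) / 2)) := by
    have hn2 : (n : ℝ) = (2 : ℝ) ^ Real.logb 2 n :=
      (Real.rpow_logb (by norm_num) (by norm_num) hn0).symm
    have : (n : ℝ) ^ a = (2 : ℝ) ^ (Real.logb 2 n * a) := by
      rw [Real.rpow_mul (by norm_num), ← hn2, Real.rpow_natCast]
    rw [this, ← Real.rpow_natCast 2 a, ← Real.rpow_natCast 2 (a.choose 2), Nat.cast_choose_two,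
      ← Real.rpow_add (by norm_num), ← Real.rpow_sub (by norm_num)]
    congr 1
    ring
  rw [e1]
  refine Real.rpow_le_rpow_of_exponent_le (by norm_num) ?_
  have ha : (k : ℝ) + 2 ≤ a + r := by exact_mod_cast (by omega : k + 2 ≤ a + r)
  have ha' : (a : ℝ) ≤ k + 1 := by exact_mod_cast hhi
  have hr0 : (0 : ℝ) ≤ r := by positivity
  have hu : (0 : ℝ) ≤ (k : ℝ) ^ (1 / 10 : ℝ) := by positivity
  calc (a : ℝ) * (1 + Real.logb 2 n - (a - 1) / 2) ≤ a * (k : ℝ) ^ (1 / 10 : ℝ) := by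
        gcongr
        linarith
    _ ≤ _ := by gcongr

theorem pow_eight_mul_ceil_le {k r : ℕ} (hk : 0 < k) (hr : (r : ℝ) ≤ Real.log k / 100)
    (h : (k : ℝ) ^ (3 / 100 : ℝ) * ((k : ℝ) ^ (3 / 5 : ℝ) + 1) ≤ (k : ℝ) ^ (2 / 3 : ℝ)) :
    ((8 ^ (r - 1) * ⌈(k : ℝ) ^ (3 / 5 : ℝ)⌉₊ : ℕ) : ℝ) ≤ (k : ℝ) ^ (2 / 3 : ℝ) := by
  have hk0 : (0 : ℝ) < k := by exact_mod_cast hk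
  have h8 : (8 : ℝ) ^ (r - 1) ≤ (k : ℝ) ^ (3 / 100 : ℝ) := by
    calc (8 : ℝ) ^ (r - 1) ≤ 8 ^ r := pow_le_pow_right₀ (by norm_num) (Nat.sub_le _ _)
      _ ≤ (Real.exp 3) ^ r := by
          gcongr
          have h2 : (2 : ℝ) ≤ Real.exp 1 := by linarith [Real.add_one_le_exp (1 : ℝ)]
          calc (8 : ℝ) = 2 ^ 3 := by norm_num
            _ ≤ Real.exp 1 ^ 3 := by gcongr
            _ = Real.exp 3 := by rw [← Real.exp_nat_mul]; norm_num
      _ = Real.exp (r * 3) := by rw [← Real.exp_nat_mul]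
      _ ≤ Real.exp (Real.log k * (3 / 100)) :=
          Real.exp_le_exp.2 (by linarith)
      _ = (k : ℝ) ^ (3 / 100 : ℝ) := by rw [Real.rpow_def_of_pos hk0]
  push_cast
  refine le_trans ?_ h
  gcongr
  exact (Nat.ceil_lt_add_one (by positivity)).le

theorem grPr_no_transversal_clique_le {n k r : ℕ} {C η : ℝ} (hn : 0 < n) (hk3 : 3 ≤ k)
    (hr : 2 ≤ r) (hnk : Real.logb 2 n ≤ k)
    (hL : 2 * Real.logb 2 n ≤ k + C + 2 * Real.logb 2 k)
    (hrk : (r : ℝ) ≤ Real.log k / 100) (hη : 0 < η)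
    (h₁ : 1 + C / 2 + Real.logb 2 k + Real.log k ≤ (k : ℝ) ^ (1 / 10 : ℝ))
    (h₂ : (k : ℝ) ^ (3 / 100 : ℝ) * ((k : ℝ) ^ (3 / 5 : ℝ) + 1) ≤ (k : ℝ) ^ (2 / 3 : ℝ))
    (h₃ : (9 * ((k : ℝ) ^ (3 : ℝ)) ^ ((k : ℝ) ^ (3 / 4 : ℝ)) *
        (2 : ℝ) ^ (((k : ℝ) + 1) * (k : ℝ) ^ (1 / 10 : ℝ))) ^ 2 *
        (2 : ℝ) ^ (-(((k : ℝ) ^ (3 / 5 : ℝ)) ^ 2 / 8)) ≤ η / (2 : ℝ) ^ (k : ℝ)) :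
    grPr n {G | ∃ A B : Fin (r - 1) → Finset (Fin n),
          (∀ i j, i ≠ j → Disjoint (A i) (A j)) ∧
          (∀ i, (edgesIn G (A i) : ℝ) ≤ (k : ℝ) ^ (3 / 4 : ℝ)) ∧
          (∀ i, k - (r - 2) ≤ (A i).card ∧ (A i).card ≤ k + 1) ∧
          (∀ i, B i ⊆ A i ∧ (k : ℝ) ^ (2 / 3 : ℝ) ≤ ((B i).card : ℝ)) ∧
          ¬ ∃ v : Fin (r - 1) → Fin n,
              (∀ i, v i ∈ B i) ∧ ∀ i j, i ≠ j → G.Adj (v i) (v j)} ≤ η / n := by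
  have hn0 : (0 : ℝ) < n := by exact_mod_cast hn
  have hk0 : (0 : ℝ) < k := by exact_mod_cast (by omega : 0 < k)
  have hk1 : (1 : ℝ) ≤ k := by exact_mod_cast (by omega : 1 ≤ k)
  have hlogk : 0 ≤ Real.log k := Real.log_nonneg hk1
  have : Nonempty (Fin n) := ⟨⟨0, hn⟩⟩
  set t := ⌈(k : ℝ) ^ (3 / 5 : ℝ)⌉₊ with ht
  have ht0 : 0 < t := Nat.ceil_pos.2 (by positivity)
  have hM : ∀ a, k - (r - 2) ≤ a → a ≤ k + 1 → (a.choose 2 : ℝ) ≤ (k : ℝ) ^ (3 : ℝ) := by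
    intro a _ ha
    have h1 : a.choose 2 ≤ (k + 1).choose 2 := Nat.choose_le_choose 2 ha
    have h2 : (k + 1).choose 2 ≤ k ^ 3 := by
      rw [Nat.choose_two_right]
      refine Nat.div_le_of_le_mul ?_
      simp only [Nat.add_sub_cancel]
      nlinarith [Nat.mul_le_mul hk3 hk3, Nat.mul_le_mul (Nat.mul_le_mul hk3 hk3) hk3]
    rw [show (3 : ℝ) = ((3 : ℕ) : ℝ) by norm_num, Real.rpow_natCast]
    exact_mod_cast h1.trans h2
  have hbound := grPr_exists_sparse_pair_le hn (k - (r - 2)) (k + 1) t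
    (s := (k : ℝ) ^ (3 / 4 : ℝ)) (M := (k : ℝ) ^ (3 : ℝ))
    (D := (2 : ℝ) ^ (((k : ℝ) + 1) * (k : ℝ) ^ (1 / 10 : ℝ)))
    (Real.one_le_rpow hk1 (by norm_num)) (by positivity) hM
    fun a hlo hhi => weight_le hn hr hlo hhi hL (by linarith) h₁
  refine (grPr_mono ?_).trans (hbound.trans ?_)
  · rintro G ⟨A, B, hdisj, hlight, hcard, hB, hno⟩
    obtain ⟨i, j, hij, T, hT, S, hS, hTt, hSt, hsparse⟩ := exists_sparse_pair ht0 G B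
      (fun i => by
        exact_mod_cast (pow_eight_mul_ceil_le (by omega) hrk h₂).trans (hB i).2) hno
    exact ⟨A i, A j, T, S, hdisj i j hij, hcard i, hcard j, hT.trans (hB i).1,
      hS.trans (hB j).1, hTt, hSt, hlight i, hlight j, hsparse⟩
  · refine le_trans ?_ (h₃.trans ?_)
    · gcongr
      · norm_num
      · exact Nat.le_ceil _
    · gcongr
      calc (n : ℝ) = (2 : ℝ) ^ Real.logb 2 n :=
            (Real.rpow_logb (by norm_num) (by norm_num) hn0).symm
        _ ≤ (2 : ℝ) ^ (k : ℝ) := Real.rpow_le_rpow_of_exponent_le (by norm_num) hnk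

theorem stmt16 (C η : ℝ) (hC : 0 < C) (hη : 0 < η) :
    ∃ ε₀ : ℝ, 0 < ε₀ ∧ ∃ N : ℕ, ∀ n : ℕ, N ≤ n → ∀ k r : ℕ,
      |(k : ℝ) - (2 * Real.logb 2 n - 2 * Real.logb 2 (Real.logb 2 n))| ≤ C →
      2 ≤ r →
      (r : ℝ) ≤ ε₀ * Real.log (Real.log n) / Real.log (Real.log (Real.log n)) →
      grPr n {G | ∃ A B : Fin (r - 1) → Finset (Fin n),
          (∀ i j, i ≠ j → Disjoint (A i) (A j)) ∧
          (∀ i, (edgesIn G (A i) : ℝ) ≤ (k : ℝ) ^ (3 / 4 : ℝ)) ∧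
          (∀ i, k - (r - 2) ≤ (A i).card ∧ (A i).card ≤ k + 1) ∧
          (∀ i, B i ⊆ A i ∧ (k : ℝ) ^ (2 / 3 : ℝ) ≤ ((B i).card : ℝ)) ∧
          ¬ ∃ v : Fin (r - 1) → Fin n,
              (∀ i, v i ∈ B i) ∧ ∀ i j, i ≠ j → G.Adj (v i) (v j)} ≤
        η / n := by
  obtain ⟨K, hK⟩ := Filter.eventually_atTop.1 ((eventually_logb_add_log_le (1 + C / 2)).and
    (eventually_rpow_mul_le.and (eventually_union_bound_le hη)))
  have hlogb : Filter.Tendsto (Real.logb 2) Filter.atTop Filter.atTop :=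
    Real.tendsto_logb_atTop (by norm_num)
  have hcast : Filter.Tendsto (fun n : ℕ => (n : ℝ)) Filter.atTop Filter.atTop :=
    tendsto_natCast_atTop_atTop
  have hL := hlogb.comp hcast
  have hlll := Real.tendsto_log_atTop.comp
    (Real.tendsto_log_atTop.comp (Real.tendsto_log_atTop.comp hcast))
  have hll := Real.tendsto_log_atTop.comp (Real.tendsto_log_atTop.comp hcast)
  have hsmall : ∀ᶠ x : ℝ in Filter.atTop, C + 2 * Real.logb 2 x ≤ x := by
    have h := (isLittleO_const_rpow_atTop C one_pos).add
      ((isLittleO_log_rpow_atTop one_pos).const_mul_left (2 * (Real.log 2)⁻¹))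
    filter_upwards [h.bound one_pos, Filter.eventually_gt_atTop 0] with x hx hx0
    rw [Real.rpow_one, one_mul, Real.norm_of_nonneg hx0.le] at hx
    refine le_trans (le_of_eq ?_) ((Real.le_norm_self _).trans hx)
    rw [Real.logb]
    ring
  obtain ⟨N, hN⟩ := Filter.eventually_atTop.1 ((hL.eventually hsmall).and
    ((hL.eventually_ge_atTop (max K 3)).and ((hlll.eventually_ge_atTop 1).and
      ((hll.eventually_ge_atTop 0).and (Filter.eventually_gt_atTop 1)))))
  refine ⟨1 / 100, by norm_num, N, fun n hn k r hk hr hrle => ?_⟩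
  obtain ⟨g₁, g₂, g₃, g₄, g₅⟩ := hN n hn
  simp only [Function.comp_apply] at g₁ g₂ g₃ g₄
  have hn1 : (1 : ℝ) < n := by exact_mod_cast g₅
  obtain ⟨hk₁, hk₂⟩ := abs_le.1 hk
  have hLk : Real.logb 2 n ≤ k := by linarith
  have hL0 : 0 < Real.logb 2 n := by linarith [le_max_right K 3]
  have hk3 : (3 : ℝ) ≤ k := (le_max_right K 3).trans (g₂.trans hLk)
  have hloglog : Real.logb 2 (Real.logb 2 n) ≤ Real.logb 2 k :=
    Real.logb_le_logb_of_le (by norm_num) hL0 hLk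
  have hlogn : 0 < Real.log n := Real.log_pos hn1
  have hlogk : Real.log (Real.log n) ≤ Real.log k := by
    refine Real.log_le_log hlogn (le_trans ?_ hLk)
    rw [Real.logb, le_div_iff₀ (Real.log_pos (by norm_num))]
    nlinarith [Real.log_two_lt_d9]
  have hrk : (r : ℝ) ≤ Real.log k / 100 := by
    refine hrle.trans ((div_le_self (by positivity) g₃).trans ?_)
    linarith
  obtain ⟨e₁, e₂, e₃⟩ := hK k ((le_max_left K 3).trans (g₂.trans hLk))
  exact grPr_no_transversal_clique_le (by omega) (by exact_mod_cast hk3) hr hLk (by linarith) hrk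
    hη e₁ e₂ e₃
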